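/- Let Ω ⊆ ℝ^n be a compact convex set with diameter D > 0, let x, s, q ∈ Ω, let g ∈ ℝ^n with ‖π(T_Ω(x), g)‖ > 0, and let PW > 0 be such that ⟨g, s − q⟩ ≥ PW · ⟨g, e/‖e‖⟩ for every e ∈ (Ω − x) \ {0} with ⟨g, e⟩ > 0. Let d ∈ {s − x, x − q} satisfy ⟨g, d⟩ = max(⟨g, s − x⟩, ⟨g, x − q⟩) and d ≠ 0 (an away-step Frank-Wolfe direction). Then ⟨g, d⟩ / (‖π(T_Ω(x), g)‖ · ‖d‖) ≥ PW / (2D). -/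

import Mathlib

open Set Metric RealInnerProductSpace

noncomputable section

/-- The tangent cone to a convex set `Ω` at `x`: the closure of the cone of feasible
directions. -/
def tangentCone {n : ℕ} (Ω : Set (EuclideanSpace ℝ (Fin n))) (x : EuclideanSpace ℝ (Fin n)) :
    Set (EuclideanSpace ℝ (Fin n)) :=
  closure {w | ∃ l : ℝ, 0 < l ∧ x + l • w ∈ Ω}

/-- The normal cone to a convex set `Ω` at `x`. -/
def normalCone {n : ℕ} (Ω : Set (EuclideanSpace ℝ (Fin n))) (x : EuclideanSpace ℝ (Fin n)) :
    Set (EuclideanSpace ℝ (Fin n)) :=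
  {v | ∀ y ∈ Ω, ⟪v, y - x⟫ ≤ 0}

/-- `p` is the Euclidean (metric) projection of `g` onto the set `C`. -/
def IsProjection {n : ℕ} (C : Set (EuclideanSpace ℝ (Fin n)))
    (g p : EuclideanSpace ℝ (Fin n)) : Prop :=
  p ∈ C ∧ ∀ w ∈ C, ‖g - p‖ ≤ ‖g - w‖

/-- The tangent cone is closed under multiplication by positive scalars. -/
theorem smul_mem_tangentCone {n : ℕ} {Ω : Set (EuclideanSpace ℝ (Fin n))}
    {x w : EuclideanSpace ℝ (Fin n)} (hw : w ∈ tangentCone Ω x) {t : ℝ} (ht : 0 < t) :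
    t • w ∈ tangentCone Ω x := by
  refine map_mem_closure (continuous_const_smul t) hw ?_
  rintro v ⟨l, hl, hv⟩
  refine ⟨l / t, by positivity, ?_⟩
  rwa [smul_smul, div_mul_cancel₀ _ ht.ne']

/-- The projection `p` of `g` onto a set stable under positive scaling satisfies
`⟪g, p⟫ = ‖p‖ ^ 2`. -/
theorem IsProjection.inner_eq_norm_sq {n : ℕ} {C : Set (EuclideanSpace ℝ (Fin n))}
    {g p : EuclideanSpace ℝ (Fin n)} (hp : IsProjection C g p)
    (hC : ∀ t : ℝ, 0 < t → t • p ∈ C) : ⟪g, p⟫ = ‖p‖ ^ 2 := by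
  rcases eq_or_ne p 0 with rfl | hp0
  · simp
  have hpos : 0 < ‖p‖ ^ 2 := by positivity
  have key : ∀ t : ℝ, 0 < t → 0 ≤ (t - 1) * ((t + 1) * ‖p‖ ^ 2 - 2 * ⟪g, p⟫) := by
    intro t ht
    have h := pow_le_pow_left₀ (norm_nonneg _) (hp.2 _ (hC t ht)) 2
    rw [norm_sub_sq_real, norm_sub_sq_real, real_inner_smul_right, norm_smul, mul_pow,
      Real.norm_eq_abs, sq_abs] at h
    linarith
  apply le_antisymm
  · by_contra! h
    have ht : 1 < ⟪g, p⟫ / ‖p‖ ^ 2 := (one_lt_div hpos).2 h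
    have h1 := key (⟪g, p⟫ / ‖p‖ ^ 2) (by linarith)
    rw [add_mul, div_mul_cancel₀ _ hpos.ne'] at h1
    nlinarith
  · by_contra! h
    have ht : ⟪g, p⟫ / ‖p‖ ^ 2 < 1 := (div_lt_one hpos).2 h
    have h1 := key (max (⟪g, p⟫ / ‖p‖ ^ 2) (1 / 2)) (lt_max_of_lt_right (by norm_num))
    have h2 : max (⟪g, p⟫ / ‖p‖ ^ 2) (1 / 2) < 1 := max_lt ht (by norm_num)
    have h3 := mul_le_mul_of_nonneg_right (le_max_left (⟪g, p⟫ / ‖p‖ ^ 2) (1 / 2)) hpos.le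
    rw [div_mul_cancel₀ _ hpos.ne'] at h3
    nlinarith

/-- A lower bound on the normalized slope of feasible directions of ascent passes to the
tangent cone. -/
theorem mul_inner_le_of_mem_tangentCone {n : ℕ} {Ω : Set (EuclideanSpace ℝ (Fin n))}
    {x g w : EuclideanSpace ℝ (Fin n)} {a b : ℝ}
    (h : ∀ e : EuclideanSpace ℝ (Fin n), (∃ y ∈ Ω, e = y - x) → e ≠ 0 →
      0 < ⟪g, e⟫ → a * ⟪g, ‖e‖⁻¹ • e⟫ ≤ b)
    (hw : w ∈ tangentCone Ω x) (hgw : 0 < ⟪g, w⟫) : a * ⟪g, w⟫ ≤ b * ‖w‖ := by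
  have hopen : IsOpen {v : EuclideanSpace ℝ (Fin n) | 0 < ⟪g, v⟫} :=
    isOpen_lt (by fun_prop) (by fun_prop)
  have hclosed : IsClosed {v : EuclideanSpace ℝ (Fin n) | a * ⟪g, v⟫ ≤ b * ‖v‖} :=
    isClosed_le (by fun_prop) (by fun_prop)
  refine closure_minimal ?_ hclosed (hopen.inter_closure ⟨hgw, hw⟩)
  rintro v ⟨hgv, l, hl, hv⟩
  have hgv : 0 < ⟪g, v⟫ := hgv
  have hv0 : v ≠ 0 := by
    rintro rfl
    simp at hgv
  have hvn : 0 < ‖v‖ := norm_pos_iff.2 hv0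
  have h1 := h (l • v) ⟨_, hv, by simp⟩ (smul_ne_zero hl.ne' hv0)
    (by rw [real_inner_smul_right]; positivity)
  rw [real_inner_smul_right, real_inner_smul_right, norm_smul, Real.norm_of_nonneg hl.le] at h1
  have h2 : a * ((l * ‖v‖)⁻¹ * (l * ⟪g, v⟫)) = a * ⟪g, v⟫ / ‖v‖ := by field_simp
  rw [h2, div_le_iff₀ hvn] at h1
  exact h1

/-- an away-step Frank-Wolfe direction `d ∈ {s - x, x - q}` achieving the
maximal slope has normalized slope at least `PW / (2D)`, given the pyramidal width
inequality for the pairwise direction `s - q`. -/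
theorem stmt4 {n : ℕ} (Ω : Set (EuclideanSpace ℝ (Fin n)))
    (hΩcp : IsCompact Ω) (hΩconv : Convex ℝ Ω)
    (D : ℝ) (hD : D = Metric.diam Ω) (hDpos : 0 < D)
    (x s q : EuclideanSpace ℝ (Fin n)) (hx : x ∈ Ω) (hs : s ∈ Ω) (hq : q ∈ Ω)
    (g p : EuclideanSpace ℝ (Fin n))
    (hp : IsProjection (tangentCone Ω x) g p) (hppos : 0 < ‖p‖)
    (PW : ℝ) (hPW : 0 < PW)
    (hslope : ∀ e : EuclideanSpace ℝ (Fin n), (∃ h ∈ Ω, e = h - x) → e ≠ 0 →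
      0 < ⟪g, e⟫ → PW * ⟪g, ‖e‖⁻¹ • e⟫ ≤ ⟪g, s - q⟫)
    (d : EuclideanSpace ℝ (Fin n))
    (hdmem : d = s - x ∨ d = x - q)
    (hdmax : ⟪g, d⟫ = max ⟪g, s - x⟫ ⟪g, x - q⟫)
    (hd0 : d ≠ 0) :
    PW / (2 * D) ≤ ⟪g, d⟫ / (‖p‖ * ‖d‖) := by
  have hgp : ⟪g, p⟫ = ‖p‖ ^ 2 :=
    hp.inner_eq_norm_sq fun t ht => smul_mem_tangentCone hp.1 ht
  have h1 := mul_inner_le_of_mem_tangentCone hslope hp.1 (by rw [hgp]; positivity)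
  rw [hgp, pow_two, ← mul_assoc] at h1
  have h2 : PW * ‖p‖ ≤ ⟪g, s - q⟫ := le_of_mul_le_mul_right h1 hppos
  have h3 : ⟪g, s - q⟫ ≤ 2 * ⟪g, d⟫ := by
    rw [← sub_add_sub_cancel s x q, inner_add_right, hdmax]
    linarith [le_max_left ⟪g, s - x⟫ ⟪g, x - q⟫, le_max_right ⟪g, s - x⟫ ⟪g, x - q⟫]
  have h4 : ‖d‖ ≤ D := by
    rw [hD]
    rcases hdmem with rfl | rfl
    · rw [← dist_eq_norm]
      exact dist_le_diam_of_mem hΩcp.isBounded hs hx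
    · rw [← dist_eq_norm]
      exact dist_le_diam_of_mem hΩcp.isBounded hx hq
  have hdn : 0 < ‖d‖ := norm_pos_iff.2 hd0
  rw [div_le_div_iff₀ (by positivity) (by positivity)]
  calc PW * (‖p‖ * ‖d‖) = PW * ‖p‖ * ‖d‖ := by ring
    _ ≤ 2 * ⟪g, d⟫ * D := by
      have := h2.trans h3
      have : 0 ≤ 2 * ⟪g, d⟫ := le_trans (by positivity) this
      gcongr
    _ = ⟪g, d⟫ * (2 * D) := by ring
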